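/- For every δ > 0 there exists ε > 0 such that the following holds for every n ≥ 1, every family of nonempty finite sets S_1, …, S_n, and every pair of product probability measures ν = ν_1 ⊗ … ⊗ ν_n and π = π_1 ⊗ … ⊗ π_n on S_1 × … × S_n with each π_i everywhere positive: if max_{1≤i≤n} ‖ν_i − π_i‖_{L∞(π_i)} < ε, then | ‖ν − π‖_TV − ( 2Φ(√M / 2) − 1 ) | < δ, where M = Σ_{i=1}^n ‖ν_i − π_i‖²_{L²(π_i)} and Φ is the cumulative distribution function of the standard normal distribution. -/

import Mathlib

noncomputable section

open ProbabilityTheory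

/-- The cumulative distribution function of the standard normal distribution. -/
def stdNormalCDF (x : ℝ) : ℝ := (gaussianReal 0 1 (Set.Iic x)).toReal

open MeasureTheory Filter Topology Complex

lemma abs_log_one_add_sub_le {x : ℝ} (hx : |x| ≤ 1 / 2) :
    |Real.log (1 + x) - x| ≤ 2 * |x| ^ 2 := by
  have h := Real.abs_log_sub_add_sum_range_le (x := -x) (by rw [abs_neg]; linarith) 1
  simp only [Finset.sum_range_one, abs_neg, sub_neg_eq_add] at h
  norm_num at h
  have h2 : |x| ^ 2 / (1 - |x|) ≤ 2 * |x| ^ 2 := by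
    rw [div_le_iff₀ (by linarith)]
    nlinarith [sq_nonneg |x|]
  rw [show Real.log (1 + x) - x = -x + Real.log (1 + x) by ring]
  simpa using h.trans (by simpa using h2)

lemma abs_log_one_add_sub_add_le {x : ℝ} (hx : |x| ≤ 1 / 2) :
    |Real.log (1 + x) - x + x ^ 2 / 2| ≤ 2 * |x| ^ 3 := by
  have h := Real.abs_log_sub_add_sum_range_le (x := -x) (by rw [abs_neg]; linarith) 2
  simp only [Finset.sum_range_succ, Finset.sum_range_zero, abs_neg, sub_neg_eq_add] at h
  norm_num at h
  have h2 : |x| ^ 3 / (1 - |x|) ≤ 2 * |x| ^ 3 := by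
    rw [div_le_iff₀ (by linarith)]
    have := pow_nonneg (abs_nonneg x) 3
    nlinarith
  rw [show Real.log (1 + x) - x + x ^ 2 / 2 = -x + x ^ 2 / 2 + Real.log (1 + x) by ring]
  exact h.trans h2

/-- The cubic error constant in the second order expansion of `(1 + x) ^ (it)` at `x = 0`. -/
def expLogConst (t : ℝ) : ℝ := 8 * |t| ^ 3 * Real.exp |t| + 3 * t ^ 2 + 2 * |t|

lemma expLogConst_nonneg (t : ℝ) : 0 ≤ expLogConst t := by
  unfold expLogConst; positivity

lemma norm_exp_log_sub_le (t : ℝ) {x : ℝ} (hx : |x| ≤ 1 / 2) :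
    ‖cexp (t * Real.log (1 + x) * I) - (1 + t * x * I - (t ^ 2 + t * I) / 2 * x ^ 2)‖
      ≤ expLogConst t * |x| ^ 3 := by
  set y := Real.log (1 + x) with hy
  have h1 := abs_log_one_add_sub_le hx
  have h2 := abs_log_one_add_sub_add_le hx
  rw [← hy] at h1 h2
  have hx0 := abs_nonneg x
  have hyx : |y| ≤ 2 * |x| := by
    have := abs_add_le (y - x) x
    rw [sub_add_cancel] at this
    nlinarith
  have h3 : |y ^ 2 - x ^ 2| ≤ 6 * |x| ^ 3 := by
    rw [show y ^ 2 - x ^ 2 = (y - x) * (y + x) by ring, abs_mul]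
    calc |y - x| * |y + x| ≤ (2 * |x| ^ 2) * (3 * |x|) := by
          gcongr
          exact (abs_add_le y x).trans (by linarith)
      _ = _ := by ring
  have h4 := Complex.norm_exp_sub_sum_le_norm_mul_exp (t * y * I) 3
  have hn : ‖(t * y * I : ℂ)‖ = |t| * |y| := by simp
  rw [hn] at h4
  have h5 : (|t| * |y|) ^ 3 * Real.exp (|t| * |y|) ≤ 8 * |t| ^ 3 * Real.exp |t| * |x| ^ 3 := by
    calc (|t| * |y|) ^ 3 * Real.exp (|t| * |y|)
        ≤ (|t| * (2 * |x|)) ^ 3 * Real.exp (|t| * 1) := by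
          gcongr
          linarith
      _ = _ := by rw [mul_one]; ring
  have key : cexp (t * y * I) - (1 + t * x * I - (t ^ 2 + t * I) / 2 * x ^ 2)
      = (cexp (t * y * I) - ∑ m ∈ Finset.range 3, (t * y * I) ^ m / m.factorial)
        + (((-(t ^ 2 / 2 * (y ^ 2 - x ^ 2)) : ℝ) : ℂ) + ((t * (y - x + x ^ 2 / 2) : ℝ) : ℂ) * I) := by
    simp only [Finset.sum_range_succ, Finset.sum_range_zero]
    push_cast
    norm_num [Nat.factorial, mul_pow, I_sq]
    ring
  rw [key]
  have h6 : ‖((-(t ^ 2 / 2 * (y ^ 2 - x ^ 2)) : ℝ) : ℂ)‖ ≤ 3 * t ^ 2 * |x| ^ 3 := by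
    rw [Complex.norm_real, Real.norm_eq_abs, abs_neg, abs_mul, abs_of_nonneg (by positivity)]
    nlinarith [sq_nonneg t]
  have h7 : ‖((t * (y - x + x ^ 2 / 2) : ℝ) : ℂ) * I‖ ≤ 2 * |t| * |x| ^ 3 := by
    rw [norm_mul, norm_I, mul_one, Complex.norm_real, Real.norm_eq_abs, abs_mul]
    nlinarith [abs_nonneg t]
  refine (norm_add_le _ _).trans ?_
  refine (add_le_add (h4.trans h5) ((norm_add_le _ _).trans (add_le_add h6 h7))).trans ?_
  unfold expLogConst
  linarith

/-- The error constant in the one-factor comparison of characteristic functions. -/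
def factorConst (t : ℝ) : ℝ := expLogConst t + (t ^ 2 + |t|) ^ 2 * Real.exp (t ^ 2 + |t|)

lemma factorConst_nonneg (t : ℝ) : 0 ≤ factorConst t := by
  have := expLogConst_nonneg t
  unfold factorConst; positivity

lemma norm_sum_exp_log_sub_exp_le (t : ℝ) {ε : ℝ} (hε : ε ≤ 1 / 2) {S : Type*} [Fintype S]
    {p ξ : S → ℝ} (hp : ∀ x, 0 ≤ p x) (hp1 : ∑ x, p x = 1) (hξ : ∑ x, p x * ξ x = 0)
    (hξε : ∀ x, |ξ x| ≤ ε) :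
    ‖∑ x, (p x : ℂ) * cexp (t * Real.log (1 + ξ x) * I)
        - cexp (-((t ^ 2 + t * I) / 2) * (∑ x, p x * ξ x ^ 2 : ℝ))‖
      ≤ factorConst t * ε * ∑ x, p x * ξ x ^ 2 := by
  set v := ∑ x, p x * ξ x ^ 2 with hv
  have hv0 : 0 ≤ v := Finset.sum_nonneg fun x _ ↦ mul_nonneg (hp x) (sq_nonneg _)
  have hε0 : 0 ≤ ε := by
    have : Nonempty S := by
      by_contra h
      rw [not_nonempty_iff] at h
      simp at hp1
    exact (abs_nonneg _).trans (hξε (Classical.arbitrary S))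
  have hvε : v ≤ ε ^ 2 := by
    calc v ≤ ∑ x, p x * ε ^ 2 := by
          refine Finset.sum_le_sum fun x _ ↦ mul_le_mul_of_nonneg_left ?_ (hp x)
          rw [← sq_abs]
          exact pow_le_pow_left₀ (abs_nonneg _) (hξε x) 2
      _ = ε ^ 2 := by rw [← Finset.sum_mul, hp1, one_mul]
  have h1 : ‖∑ x, (p x : ℂ) * cexp (t * Real.log (1 + ξ x) * I)
      - (1 - (t ^ 2 + t * I) / 2 * (v : ℂ))‖ ≤ expLogConst t * ε * v := by
    have e : (1 - (t ^ 2 + t * I) / 2 * (v : ℂ))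
        = ∑ x, (p x : ℂ) * (1 + t * ξ x * I - (t ^ 2 + t * I) / 2 * ξ x ^ 2) := by
      have a1 : ∑ x, (p x : ℂ) = 1 := by exact_mod_cast hp1
      have a2 : ∑ x, (p x : ℂ) * ξ x = 0 := by exact_mod_cast hξ
      have a3 : (v : ℂ) = ∑ x, (p x : ℂ) * ξ x ^ 2 := by rw [hv]; push_cast; rfl
      calc (1 - (t ^ 2 + t * I) / 2 * (v : ℂ))
          = ∑ x, (p x : ℂ) + t * I * ∑ x, (p x : ℂ) * ξ x
            - (t ^ 2 + t * I) / 2 * ∑ x, (p x : ℂ) * ξ x ^ 2 := by rw [a1, a2, a3]; ring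
        _ = _ := by
          rw [Finset.mul_sum, Finset.mul_sum, ← Finset.sum_add_distrib, ← Finset.sum_sub_distrib]
          exact Finset.sum_congr rfl fun x _ ↦ by ring
    rw [e, ← Finset.sum_sub_distrib]
    refine (norm_sum_le _ _).trans ?_
    rw [hv, Finset.mul_sum]
    refine Finset.sum_le_sum fun x _ ↦ ?_
    rw [← mul_sub, norm_mul, Complex.norm_real, Real.norm_of_nonneg (hp x)]
    calc p x * _ ≤ p x * (expLogConst t * |ξ x| ^ 3) :=
          mul_le_mul_of_nonneg_left (norm_exp_log_sub_le t ((hξε x).trans hε)) (hp x)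
      _ = p x * (expLogConst t * |ξ x| * ξ x ^ 2) := by rw [← sq_abs (ξ x)]; ring
      _ ≤ p x * (expLogConst t * ε * ξ x ^ 2) := by
          have := expLogConst_nonneg t
          have := hp x
          gcongr
          exact hξε x
      _ = _ := by ring
  set A := t ^ 2 + |t| with hA
  have hA0 : 0 ≤ A := by positivity
  have h2 : ‖cexp (-((t ^ 2 + t * I) / 2) * (v : ℂ)) - (1 - (t ^ 2 + t * I) / 2 * (v : ℂ))‖
      ≤ A ^ 2 * Real.exp A * ε * v := by
    have h := Complex.norm_exp_sub_sum_le_norm_mul_exp (-((t ^ 2 + t * I) / 2) * (v : ℂ)) 2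
    have hw : ‖-((t ^ 2 + t * I) / 2) * (v : ℂ)‖ ≤ A * v := by
      rw [norm_mul, norm_neg, norm_div, Complex.norm_real, Real.norm_of_nonneg hv0]
      gcongr
      have : ‖(t : ℂ) ^ 2 + t * I‖ ≤ A := (norm_add_le _ _).trans (by simp [hA])
      norm_num
      linarith
    have e : ∑ m ∈ Finset.range 2, (-((t ^ 2 + t * I) / 2) * (v : ℂ)) ^ m / m.factorial
        = 1 - (t ^ 2 + t * I) / 2 * (v : ℂ) := by
      simp [Finset.sum_range_succ]; ring
    rw [e] at h
    refine h.trans ?_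
    have hv1 : v ≤ 1 := by nlinarith
    calc _ ≤ (A * v) ^ 2 * Real.exp (A * 1) := by
          gcongr
          exact hw.trans (by gcongr)
      _ = A ^ 2 * Real.exp A * v * v := by rw [mul_one]; ring
      _ ≤ A ^ 2 * Real.exp A * ε * v := by
          gcongr
          nlinarith
  rw [show factorConst t * ε * v = expLogConst t * ε * v + A ^ 2 * Real.exp A * ε * v by
    unfold factorConst; ring]
  rw [norm_sub_rev] at h2
  exact (norm_sub_le_norm_sub_add_norm_sub _ _ _).trans (add_le_add h1 h2)

lemma norm_prod_sub_prod_le_sum {ι : Type*} (s : Finset ι) {a b : ι → ℂ} (ha : ∀ i, ‖a i‖ ≤ 1)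
    (hb : ∀ i, ‖b i‖ ≤ 1) :
    ‖∏ i ∈ s, a i - ∏ i ∈ s, b i‖ ≤ ∑ i ∈ s, ‖a i - b i‖ := by
  classical
  induction s using Finset.induction_on with
  | empty => simp
  | insert i s hi ih =>
    rw [Finset.prod_insert hi, Finset.prod_insert hi, Finset.sum_insert hi]
    have hp : ‖∏ j ∈ s, b j‖ ≤ 1 := by
      rw [norm_prod]
      exact Finset.prod_le_one (fun _ _ ↦ norm_nonneg _) fun j _ ↦ hb j
    calc ‖a i * ∏ j ∈ s, a j - b i * ∏ j ∈ s, b j‖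
        = ‖a i * (∏ j ∈ s, a j - ∏ j ∈ s, b j) + (a i - b i) * ∏ j ∈ s, b j‖ := by ring_nf
      _ ≤ 1 * ‖∏ j ∈ s, a j - ∏ j ∈ s, b j‖ + ‖a i - b i‖ * 1 := by
          refine (norm_add_le _ _).trans ?_
          rw [norm_mul, norm_mul]
          gcongr
          exact ha i
      _ ≤ _ := by linarith

lemma stdNormalCDF_neg (a : ℝ) : stdNormalCDF (-a) = 1 - stdNormalCDF a := by
  have : NullSingletonClass (gaussianReal 0 1) := nullSingletonClass_gaussianReal one_ne_zero
  have h1 : gaussianReal 0 1 (Set.Iic (-a)) = gaussianReal 0 1 (Set.Ioi a) := by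
    conv_lhs => rw [← neg_zero, ← gaussianReal_map_neg]
    rw [Measure.map_apply measurable_neg measurableSet_Iic]
    rw [show (fun x : ℝ ↦ -x) ⁻¹' Set.Iic (-a) = Set.Ici a by ext; simp]
    exact measure_congr Ioi_ae_eq_Ici.symm
  change (gaussianReal 0 1).real _ = 1 - (gaussianReal 0 1).real _
  rw [← probReal_compl_eq_one_sub measurableSet_Iic, Set.compl_Iic]
  exact congrArg ENNReal.toReal h1

lemma gaussianReal_self_real_Iic_half (s : ℝ) :
    (gaussianReal s 1).real (Set.Iic (s / 2)) = 1 - stdNormalCDF (s / 2) := by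
  rw [← stdNormalCDF_neg, stdNormalCDF, measureReal_def]
  congr 1
  conv_lhs => rw [← zero_add s, ← gaussianReal_map_add_const]
  rw [Measure.map_apply (by fun_prop) measurableSet_Iic]
  congr 1
  ext x
  simp only [Set.mem_preimage, Set.mem_Iic, zero_add]
  constructor <;> intro h <;> linarith

lemma gaussianPDFReal_mul_exp (s x : ℝ) :
    gaussianPDFReal 0 1 x * Real.exp (s * x - s ^ 2 / 2) = gaussianPDFReal s 1 x := by
  simp only [gaussianPDFReal, mul_assoc, ← Real.exp_add]
  congr 3
  push_cast
  ring

lemma integral_indicator_exp_gaussianReal (s : ℝ) {A : Set ℝ} (hA : MeasurableSet A) :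
    ∫ x, A.indicator (fun x ↦ Real.exp (s * x - s ^ 2 / 2)) x ∂gaussianReal 0 1
      = (gaussianReal s 1).real A := by
  rw [← integral_indicator_one hA, integral_gaussianReal_eq_integral_smul one_ne_zero,
    integral_gaussianReal_eq_integral_smul one_ne_zero]
  congr 1
  ext x
  by_cases hx : x ∈ A
  · simp [hx, gaussianPDFReal_mul_exp]
  · simp [hx]

lemma gaussianReal_map_affine (s : ℝ) :
    (gaussianReal 0 1).map (fun x ↦ s * x - s ^ 2 / 2)
      = gaussianReal (-(s ^ 2 / 2)) (NNReal.mk (s ^ 2) (sq_nonneg s)) := by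
  have h : (fun x ↦ s * x - s ^ 2 / 2) = (fun x ↦ x - s ^ 2 / 2) ∘ (fun x ↦ s * x) := rfl
  rw [h, ← Measure.map_map (by fun_prop) (by fun_prop), gaussianReal_map_const_mul,
    gaussianReal_map_sub_const]
  congr 1
  · simp
  · exact mul_one _

/-- The bounded continuous function `x ↦ (1 - e ^ x)⁺`. -/
def expDeficit : BoundedContinuousFunction ℝ ℝ :=
  BoundedContinuousFunction.ofNormedAddCommGroup (fun x ↦ max (1 - Real.exp x) 0)
    (by fun_prop) 1 fun x ↦ by
      rw [Real.norm_of_nonneg (le_max_right _ _)]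
      exact max_le (by linarith [Real.exp_pos x]) zero_le_one

lemma expDeficit_apply (x : ℝ) : expDeficit x = max (1 - Real.exp x) 0 := rfl

lemma integral_expDeficit_gaussianReal {s : ℝ} (hs : 0 ≤ s) :
    ∫ x, expDeficit x ∂gaussianReal (-(s ^ 2 / 2)) (NNReal.mk (s ^ 2) (sq_nonneg s))
      = 2 * stdNormalCDF (s / 2) - 1 := by
  rw [← gaussianReal_map_affine, integral_map (by fun_prop)
    expDeficit.continuous.aestronglyMeasurable]
  have h : ∀ x, expDeficit (s * x - s ^ 2 / 2) = (Set.Iic (s / 2)).indicator 1 x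
      - (Set.Iic (s / 2)).indicator (fun x ↦ Real.exp (s * x - s ^ 2 / 2)) x := by
    intro x
    rw [expDeficit_apply]
    by_cases hx : x ∈ Set.Iic (s / 2)
    · rw [Set.indicator_of_mem hx, Set.indicator_of_mem hx, Pi.one_apply, max_eq_left]
      rw [sub_nonneg, Real.exp_le_one_iff]
      rw [Set.mem_Iic] at hx
      nlinarith
    · rw [Set.indicator_of_notMem hx, Set.indicator_of_notMem hx, sub_zero, max_eq_right]
      rw [sub_nonpos, Real.one_le_exp_iff]
      rw [Set.mem_Iic, not_le] at hx
      nlinarith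
  simp_rw [h]
  rw [integral_sub, integral_indicator_exp_gaussianReal s measurableSet_Iic,
    integral_indicator_one measurableSet_Iic, gaussianReal_self_real_Iic_half]
  · rw [stdNormalCDF, measureReal_def]; ring
  · exact (integrable_const (1 : ℝ)).indicator measurableSet_Iic
  · refine Integrable.indicator ?_ measurableSet_Iic
    simp_rw [Real.exp_sub]
    exact (integrable_exp_mul_gaussianReal s).div_const _

lemma exists_forall_integral_expDeficit_close (K : ℝ → ℝ) (R : ℝ) {δ : ℝ} (hδ : 0 < δ) :
    ∃ ε > (0 : ℝ), ∀ (μ : ProbabilityMeasure ℝ) (s : ℝ), 0 ≤ s → s ≤ R →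
      (∀ t : ℝ, ‖charFun (μ : Measure ℝ) t - cexp (-((t ^ 2 + t * I) / 2) * (s ^ 2 : ℝ))‖
        ≤ K t * ε) →
      |∫ x, expDeficit x ∂(μ : Measure ℝ) - (2 * stdNormalCDF (s / 2) - 1)| < δ := by
  by_contra! hcon
  choose μ s hs0 hsR hμ hd using fun k : ℕ ↦ hcon (1 / ((k : ℝ) + 1)) (by positivity)
  obtain ⟨a, ha, φ, hφ, hlim⟩ := (isCompact_Icc (a := 0) (b := R)).tendsto_subseq
    (x := s) fun k ↦ ⟨hs0 k, hsR k⟩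
  let G (r : ℝ) : ProbabilityMeasure ℝ :=
    ⟨gaussianReal (-(r ^ 2 / 2)) (NNReal.mk (r ^ 2) (sq_nonneg r)), inferInstance⟩
  have hG (r t : ℝ) : charFun (G r : Measure ℝ) t
      = cexp (-((t ^ 2 + t * I) / 2) * (r ^ 2 : ℝ)) := by
    change charFun (gaussianReal _ _) t = _
    rw [charFun_gaussianReal]
    congr 1
    simp only [NNReal.coe_mk]
    push_cast
    ring
  have hexp (t : ℝ) : Tendsto (fun k ↦ charFun (G (s (φ k)) : Measure ℝ) t) atTop
      (𝓝 (charFun (G a : Measure ℝ) t)) := by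
    simp_rw [hG]
    have hc : Continuous fun r : ℝ ↦ cexp (-((t ^ 2 + t * I) / 2) * (r ^ 2 : ℝ)) := by fun_prop
    exact (hc.tendsto a).comp hlim
  have hGlim : Tendsto (fun k ↦ G (s (φ k))) atTop (𝓝 (G a)) :=
    ProbabilityMeasure.tendsto_of_tendsto_charFun hexp
  have hμlim : Tendsto (fun k ↦ μ (φ k)) atTop (𝓝 (G a)) := by
    refine ProbabilityMeasure.tendsto_of_tendsto_charFun fun t ↦ ?_
    have h0 : Tendsto (fun k ↦ charFun (μ (φ k) : Measure ℝ) t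
        - charFun (G (s (φ k)) : Measure ℝ) t) atTop (𝓝 0) := by
      refine squeeze_zero_norm (a := fun k ↦ K t * (1 / ((φ k : ℝ) + 1))) (fun k ↦ ?_) ?_
      · rw [hG]
        exact hμ (φ k) t
      · simpa using (tendsto_one_div_add_atTop_nhds_zero_nat.comp hφ.tendsto_atTop).const_mul (K t)
    simpa using h0.add (hexp t)
  have h1 := ProbabilityMeasure.tendsto_iff_forall_integral_tendsto.1 hμlim expDeficit
  have h2 := ProbabilityMeasure.tendsto_iff_forall_integral_tendsto.1 hGlim expDeficit
  have h3 := (h1.sub h2).abs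
  rw [sub_self, abs_zero] at h3
  obtain ⟨k, hk⟩ := (h3.eventually_lt_const hδ).exists
  refine (hd (φ k)).not_gt ?_
  rw [← integral_expDeficit_gaussianReal (hs0 _)]
  exact hk

lemma tendsto_stdNormalCDF_atTop : Tendsto stdNormalCDF atTop (𝓝 1) := by
  have h := tendsto_cdf_atTop (gaussianReal 0 1)
  refine h.congr fun x ↦ ?_
  rw [cdf_eq_real]
  rfl

lemma stdNormalCDF_le_one (x : ℝ) : stdNormalCDF x ≤ 1 :=
  measureReal_le_one (μ := gaussianReal 0 1)

/-- The law of the real random variable `Z` on a finite type with weights `p`. -/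
def finiteLaw {S : Type*} [Fintype S] (p Z : S → ℝ) : Measure ℝ :=
  ∑ x, ENNReal.ofReal (p x) • Measure.dirac (Z x)

lemma isProbabilityMeasure_finiteLaw {S : Type*} [Fintype S] {p : S → ℝ} (Z : S → ℝ)
    (hp : ∀ x, 0 ≤ p x) (hp1 : ∑ x, p x = 1) : IsProbabilityMeasure (finiteLaw p Z) := by
  constructor
  simp [finiteLaw, ← ENNReal.ofReal_sum_of_nonneg fun x _ ↦ hp x, hp1]

lemma integral_finiteLaw {S E : Type*} [Fintype S] [NormedAddCommGroup E] [NormedSpace ℝ E]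
    [CompleteSpace E] {p : S → ℝ} (Z : S → ℝ) (hp : ∀ x, 0 ≤ p x) (f : ℝ → E) :
    ∫ y, f y ∂finiteLaw p Z = ∑ x, p x • f (Z x) := by
  rw [finiteLaw, integral_finsetSum_measure]
  · refine Finset.sum_congr rfl fun x _ ↦ ?_
    rw [integral_smul_measure, integral_dirac, ENNReal.toReal_ofReal (hp x)]
  · exact fun x _ ↦ (integrable_dirac (by simp)).smul_measure ENNReal.ofReal_ne_top

lemma sum_mul_one_add {S : Type*} [Fintype S] {p ξ : S → ℝ} (hp1 : ∑ x, p x = 1)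
    (hξ : ∑ x, p x * ξ x = 0) : ∑ x, p x * (1 + ξ x) = 1 := by
  simp_rw [mul_add, mul_one, Finset.sum_add_distrib, hp1, hξ, add_zero]

section Product

variable {ι : Type*} [Fintype ι] [DecidableEq ι] {S : ι → Type*} [∀ i, Fintype (S i)]
  {p ξ : ∀ i, S i → ℝ} {ε : ℝ}

lemma sum_prod_eq_one (hp1 : ∀ i, ∑ x, p i x = 1) : ∑ x : (∀ i, S i), ∏ i, p i (x i) = 1 := by
  rw [← Fintype.prod_sum]
  exact Finset.prod_eq_one fun i _ ↦ hp1 i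

lemma half_sum_abs_sub_eq_integral (hp : ∀ i x, 0 ≤ p i x) (hp1 : ∀ i, ∑ x, p i x = 1)
    (hξ : ∀ i, ∑ x, p i x * ξ i x = 0) (hpos : ∀ i x, 0 < 1 + ξ i x) :
    (1 / 2) * ∑ x : (∀ i, S i), |∏ i, p i (x i) * (1 + ξ i (x i)) - ∏ i, p i (x i)|
      = ∫ y, expDeficit y ∂finiteLaw (fun x : (∀ i, S i) ↦ ∏ i, p i (x i))
          (fun x ↦ ∑ i, Real.log (1 + ξ i (x i))) := by
  rw [integral_finiteLaw _ fun x ↦ Finset.prod_nonneg fun i _ ↦ hp i _]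
  have h1 := sum_prod_eq_one hp1
  have h2 := sum_prod_eq_one (fun i ↦ sum_mul_one_add (hp1 i) (hξ i))
  have h3 : ∀ x : (∀ i, S i), (∏ i, p i (x i)) • expDeficit (∑ i, Real.log (1 + ξ i (x i)))
      = (1 / 2) * |∏ i, p i (x i) * (1 + ξ i (x i)) - ∏ i, p i (x i)|
        + ((1 / 2) * ∏ i, p i (x i) - (1 / 2) * ∏ i, p i (x i) * (1 + ξ i (x i))) := by
    intro x
    have hP : 0 ≤ ∏ i, p i (x i) := Finset.prod_nonneg fun i _ ↦ hp i _
    rw [expDeficit_apply, Real.exp_sum, Finset.prod_mul_distrib]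
    simp_rw [Real.exp_log (hpos _ _)]
    set P := ∏ i, p i (x i)
    set L := ∏ i, (1 + ξ i (x i))
    rw [show P * L - P = P * (L - 1) by ring, abs_mul, abs_of_nonneg hP, smul_eq_mul]
    rcases le_total L 1 with h | h
    · rw [max_eq_left (by linarith), abs_of_nonpos (by linarith)]; ring
    · rw [max_eq_right (by linarith), abs_of_nonneg (by linarith)]; ring
  simp_rw [h3]
  rw [Finset.sum_add_distrib, Finset.sum_sub_distrib, ← Finset.mul_sum, ← Finset.mul_sum,
    ← Finset.mul_sum, h1, h2]
  ring

lemma norm_charFun_finiteLaw_sub_le (hε : ε ≤ 1 / 2) (hp : ∀ i x, 0 ≤ p i x)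
    (hp1 : ∀ i, ∑ x, p i x = 1) (hξ : ∀ i, ∑ x, p i x * ξ i x = 0)
    (hξε : ∀ i x, |ξ i x| ≤ ε) (t : ℝ) :
    ‖charFun (finiteLaw (fun x : (∀ i, S i) ↦ ∏ i, p i (x i))
          (fun x ↦ ∑ i, Real.log (1 + ξ i (x i)))) t
        - cexp (-((t ^ 2 + t * I) / 2) * (∑ i, ∑ x, p i x * ξ i x ^ 2 : ℝ))‖
      ≤ factorConst t * ε * ∑ i, ∑ x, p i x * ξ i x ^ 2 := by
  rw [charFun_apply_real, integral_finiteLaw _ fun x ↦ Finset.prod_nonneg fun i _ ↦ hp i _]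
  have h1 : ∑ x : (∀ i, S i), (∏ i, p i (x i)) •
      cexp (t * (∑ i, Real.log (1 + ξ i (x i)) : ℝ) * I)
      = ∏ i, ∑ x, (p i x : ℂ) * cexp (t * Real.log (1 + ξ i x) * I) := by
    rw [Fintype.prod_sum]
    refine Finset.sum_congr rfl fun x _ ↦ ?_
    rw [Finset.prod_mul_distrib, ← Complex.exp_sum, Complex.real_smul]
    push_cast
    rw [Finset.mul_sum, Finset.sum_mul]
  have h2 : cexp (-((t ^ 2 + t * I) / 2) * (∑ i, ∑ x, p i x * ξ i x ^ 2 : ℝ))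
      = ∏ i, cexp (-((t ^ 2 + t * I) / 2) * (∑ x, p i x * ξ i x ^ 2 : ℝ)) := by
    rw [← Complex.exp_sum, ← Finset.mul_sum]
    push_cast
    rfl
  rw [h1, h2, Finset.mul_sum]
  refine (norm_prod_sub_prod_le_sum _ (fun i ↦ ?_) fun i ↦ ?_).trans
    (Finset.sum_le_sum fun i _ ↦ norm_sum_exp_log_sub_exp_le t hε (hp i) (hp1 i) (hξ i) (hξε i))
  · refine (norm_sum_le _ _).trans ?_
    rw [← hp1 i]
    refine Finset.sum_le_sum fun x _ ↦ ?_
    rw [norm_mul, Complex.norm_real, Real.norm_of_nonneg (hp i x), ← Complex.ofReal_mul,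
      Complex.norm_exp_ofReal_mul_I, mul_one]
  · have hv : 0 ≤ ∑ x, p i x * ξ i x ^ 2 :=
      Finset.sum_nonneg fun x _ ↦ mul_nonneg (hp i x) (sq_nonneg _)
    rw [Complex.norm_exp, Real.exp_le_one_iff]
    set v := ∑ x, p i x * ξ i x ^ 2
    have : (-(((t : ℂ) ^ 2 + t * I) / 2) * (v : ℂ)).re = -(t ^ 2 / 2 * v) := by
      rw [show -(((t : ℂ) ^ 2 + t * I) / 2) * (v : ℂ)
        = ((-(t ^ 2 / 2 * v) : ℝ) : ℂ) + ((-(t / 2 * v) : ℝ) : ℂ) * I by push_cast; ring]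
      rw [add_re, ofReal_re, re_ofReal_mul, I_re, mul_zero, add_zero]
    rw [this]
    have : 0 ≤ t ^ 2 / 2 * v := by positivity
    linarith

lemma add_sub_two_mul_sqrt_le_abs_sub {a b : ℝ} (ha : 0 ≤ a) (hb : 0 ≤ b) :
    a + b - 2 * √(a * b) ≤ |a - b| := by
  wlog h : b ≤ a generalizing a b
  · rw [abs_sub_comm, add_comm, mul_comm a]
    exact this hb ha (le_of_not_ge h)
  have : b ≤ √(a * b) := Real.le_sqrt_of_sq_le (by nlinarith)
  rw [abs_of_nonneg (by linarith)]
  linarith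

lemma sqrt_one_add_le {x : ℝ} (hx : |x| ≤ 1 / 2) : √(1 + x) ≤ 1 + x / 2 - x ^ 2 / 16 := by
  obtain ⟨h1, h2⟩ := abs_le.1 hx
  apply Real.sqrt_le_iff.2 ⟨by nlinarith, ?_⟩
  nlinarith [mul_nonneg (sq_nonneg x) (show 0 ≤ 1 / 8 - x / 16 + x ^ 2 / 256 by nlinarith)]

lemma one_sub_exp_le_half_sum_abs_sub (hp : ∀ i x, 0 ≤ p i x) (hp1 : ∀ i, ∑ x, p i x = 1)
    (hξ : ∀ i, ∑ x, p i x * ξ i x = 0) (hξ2 : ∀ i x, |ξ i x| ≤ 1 / 2) :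
    1 - Real.exp (-(∑ i, ∑ x, p i x * ξ i x ^ 2) / 16)
      ≤ (1 / 2) * ∑ x : (∀ i, S i), |∏ i, p i (x i) * (1 + ξ i (x i)) - ∏ i, p i (x i)| := by
  have hpos : ∀ i x, 0 ≤ 1 + ξ i x := fun i x ↦ by linarith [(abs_le.1 (hξ2 i x)).1]
  have h1 := sum_prod_eq_one hp1
  have h2 := sum_prod_eq_one (fun i ↦ sum_mul_one_add (hp1 i) (hξ i))
  have haff : ∑ x : (∀ i, S i), √((∏ i, p i (x i) * (1 + ξ i (x i))) * ∏ i, p i (x i))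
      ≤ Real.exp (-(∑ i, ∑ x, p i x * ξ i x ^ 2) / 16) := by
    have e : ∀ x : (∀ i, S i), √((∏ i, p i (x i) * (1 + ξ i (x i))) * ∏ i, p i (x i))
        = ∏ i, p i (x i) * √(1 + ξ i (x i)) := by
      intro x
      rw [← Finset.prod_mul_distrib, Real.sqrt_eq_iff_mul_self_eq, ← Finset.prod_mul_distrib]
      · refine Finset.prod_congr rfl fun i _ ↦ ?_
        rw [mul_mul_mul_comm, Real.mul_self_sqrt (hpos _ _)]
        ring
      · exact Finset.prod_nonneg fun i _ ↦ mul_nonneg (mul_nonneg (hp _ _) (hpos _ _)) (hp _ _)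
      · exact Finset.prod_nonneg fun i _ ↦ mul_nonneg (hp _ _) (Real.sqrt_nonneg _)
    simp_rw [e]
    rw [← Fintype.prod_sum (fun i x ↦ p i x * √(1 + ξ i x)), ← Finset.sum_neg_distrib,
      Finset.sum_div, Real.exp_sum]
    refine Finset.prod_le_prod (fun i _ ↦ Finset.sum_nonneg fun x _ ↦
      mul_nonneg (hp _ _) (Real.sqrt_nonneg _)) fun i _ ↦ ?_
    calc ∑ x, p i x * √(1 + ξ i x)
        ≤ ∑ x, (p i x + 1 / 2 * (p i x * ξ i x) - 1 / 16 * (p i x * ξ i x ^ 2)) := by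
          refine Finset.sum_le_sum fun x _ ↦ ?_
          exact (mul_le_mul_of_nonneg_left (sqrt_one_add_le (hξ2 i x)) (hp i x)).trans_eq (by ring)
      _ = -(∑ x, p i x * ξ i x ^ 2) / 16 + 1 := by
          rw [Finset.sum_sub_distrib, Finset.sum_add_distrib, ← Finset.mul_sum, ← Finset.mul_sum,
            hp1, hξ]
          ring
      _ ≤ _ := Real.add_one_le_exp _
  have hle := Finset.sum_le_sum fun (x : ∀ i, S i) (_ : x ∈ Finset.univ) ↦
    add_sub_two_mul_sqrt_le_abs_sub
      (Finset.prod_nonneg fun i (_ : i ∈ Finset.univ) ↦ mul_nonneg (hp i (x i)) (hpos i (x i)))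
      (Finset.prod_nonneg fun i (_ : i ∈ Finset.univ) ↦ hp i (x i))
  rw [Finset.sum_sub_distrib, Finset.sum_add_distrib, ← Finset.mul_sum, h1, h2] at hle
  linarith

lemma half_sum_abs_sub_le_one (hp : ∀ i x, 0 ≤ p i x) (hp1 : ∀ i, ∑ x, p i x = 1)
    (hξ : ∀ i, ∑ x, p i x * ξ i x = 0) (hpos : ∀ i x, 0 ≤ 1 + ξ i x) :
    (1 / 2) * ∑ x : (∀ i, S i), |∏ i, p i (x i) * (1 + ξ i (x i)) - ∏ i, p i (x i)| ≤ 1 := by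
  have h1 := sum_prod_eq_one hp1
  have h2 := sum_prod_eq_one (fun i ↦ sum_mul_one_add (hp1 i) (hξ i))
  have hle := Finset.sum_le_sum fun (x : ∀ i, S i) (_ : x ∈ Finset.univ) ↦
    norm_sub_le (∏ i, p i (x i) * (1 + ξ i (x i))) (∏ i, p i (x i))
  have habs : ∀ x : (∀ i, S i), |∏ i, p i (x i) * (1 + ξ i (x i))| + |∏ i, p i (x i)|
      = ∏ i, p i (x i) * (1 + ξ i (x i)) + ∏ i, p i (x i) := fun x ↦ by
    rw [abs_of_nonneg (Finset.prod_nonneg fun i _ ↦ mul_nonneg (hp _ _) (hpos _ _)),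
      abs_of_nonneg (Finset.prod_nonneg fun i _ ↦ hp _ _)]
  simp_rw [Real.norm_eq_abs, habs] at hle
  rw [Finset.sum_add_distrib, h1, h2] at hle
  linarith

end Product

lemma exists_forall_half_sum_abs_sub_close {δ : ℝ} (hδ : 0 < δ) :
    ∃ ε > (0 : ℝ), ∀ (n : ℕ) (S : Fin n → Type) (_ : ∀ i, Fintype (S i))
      (p ξ : ∀ i, S i → ℝ), (∀ i x, 0 ≤ p i x) → (∀ i, ∑ x, p i x = 1) →
      (∀ i, ∑ x, p i x * ξ i x = 0) → (∀ i x, |ξ i x| ≤ ε) →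
      |(1 / 2) * ∑ x : (∀ i, S i), |∏ i, p i (x i) * (1 + ξ i (x i)) - ∏ i, p i (x i)|
        - (2 * stdNormalCDF (√(∑ i, ∑ x, p i x * ξ i x ^ 2) / 2) - 1)| < δ := by
  have hexp : Tendsto (fun M : ℝ ↦ Real.exp (-M / 16)) atTop (𝓝 0) :=
    Real.tendsto_exp_atBot.comp (tendsto_neg_atTop_atBot.atBot_div_const (by norm_num))
  have hcdf : Tendsto (fun M : ℝ ↦ 2 * stdNormalCDF (√M / 2) - 1) atTop (𝓝 1) := by
    have := tendsto_stdNormalCDF_atTop.comp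
      (Real.tendsto_sqrt_atTop.atTop_div_const (show (0 : ℝ) < 2 by norm_num))
    convert! (this.const_mul 2).sub_const 1 using 2
    norm_num
  obtain ⟨R, hR⟩ := eventually_atTop.1 ((hexp.eventually_lt_const hδ).and
    (hcdf.eventually_const_lt (show 1 - δ < 1 by linarith)))
  obtain ⟨ε, hε, hclose⟩ :=
    exists_forall_integral_expDeficit_close (fun t ↦ factorConst t * R) (√R) hδ
  refine ⟨min ε (1 / 2), lt_min hε (by norm_num), ?_⟩
  intro n S _ p ξ hp hp1 hξ hξε
  have hξ2 : ∀ i x, |ξ i x| ≤ 1 / 2 := fun i x ↦ (hξε i x).trans (min_le_right _ _)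
  have hpos : ∀ i x, 0 < 1 + ξ i x := fun i x ↦ by linarith [(abs_le.1 (hξ2 i x)).1]
  set M := ∑ i, ∑ x, p i x * ξ i x ^ 2 with hM
  have hM0 : 0 ≤ M := Finset.sum_nonneg fun i _ ↦ Finset.sum_nonneg fun x _ ↦
    mul_nonneg (hp i x) (sq_nonneg _)
  rcases le_total R M with h | h
  · obtain ⟨h1, h2⟩ := hR M h
    have h3 := one_sub_exp_le_half_sum_abs_sub hp hp1 hξ hξ2
    have h4 := half_sum_abs_sub_le_one hp hp1 hξ fun i x ↦ (hpos i x).le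
    have h5 := stdNormalCDF_le_one (√M / 2)
    rw [← hM] at h3
    rw [abs_lt]
    constructor <;> linarith
  · rw [half_sum_abs_sub_eq_integral hp hp1 hξ hpos]
    refine hclose ⟨_, isProbabilityMeasure_finiteLaw _
      (fun x ↦ Finset.prod_nonneg fun i _ ↦ hp i _) (sum_prod_eq_one hp1)⟩ _
      (Real.sqrt_nonneg _) (Real.sqrt_le_sqrt h) fun t ↦ ?_
    rw [Real.sq_sqrt hM0]
    refine (norm_charFun_finiteLaw_sub_le (min_le_right ε (1 / 2)) hp hp1 hξ hξε t).trans ?_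
    rw [← hM, mul_right_comm]
    have hK := factorConst_nonneg t
    exact mul_le_mul (mul_le_mul_of_nonneg_left h hK) (min_le_left _ _)
      (lt_min hε (by norm_num)).le (mul_nonneg hK (hM0.trans h))

theorem stmt_2 :
    ∀ δ > (0 : ℝ), ∃ ε > (0 : ℝ),
      ∀ (n : ℕ), 1 ≤ n →
      ∀ (S : Fin n → Type) (_ : ∀ i, Fintype (S i)) (_ : ∀ i, Nonempty (S i))
        (ν π : ∀ i, S i → ℝ),
        (∀ i x, 0 ≤ ν i x) → (∀ i, ∑ x, ν i x = 1) →
        (∀ i x, 0 < π i x) → (∀ i, ∑ x, π i x = 1) →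
        (∀ i, (⨆ x, |ν i x / π i x - 1|) < ε) →
        |(1 / 2) * (∑ x : (∀ i, S i), |(∏ i, ν i (x i)) - (∏ i, π i (x i))|) -
            (2 * stdNormalCDF
              (Real.sqrt (∑ i, ∑ x, |ν i x / π i x - 1| ^ 2 * π i x) / 2) - 1)| < δ := by
  intro δ hδ
  obtain ⟨ε, hε, h⟩ := exists_forall_half_sum_abs_sub_close hδ
  refine ⟨ε, hε, fun n _ S _ _ ν π _ hν1 hπ hπ1 hsup ↦ ?_⟩
  have hmul : ∀ i x, π i x * (1 + (ν i x / π i x - 1)) = ν i x := fun i x ↦ by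
    rw [add_sub_cancel, mul_div_cancel₀ _ (hπ i x).ne']
  have key := h n S _ π (fun i x ↦ ν i x / π i x - 1) (fun i x ↦ (hπ i x).le) hπ1 ?_ ?_
  · simp_rw [hmul] at key
    simp_rw [sq_abs, mul_comm _ (π _ _)]
    exact key
  · intro i
    simp_rw [mul_sub, mul_one, mul_div_cancel₀ _ (hπ i _).ne', Finset.sum_sub_distrib, hν1, hπ1,
      sub_self]
  · intro i x
    exact (le_ciSup (f := fun x ↦ |ν i x / π i x - 1|) (Set.finite_range _).bddAbove x).trans
      (hsup i).le
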